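/- The map that sends a square-ice configuration on L_n to the n×n matrix whose (i,j) entry corresponds to the interior vertex in row i and column j, with entry 1 if both horizontal edges at that vertex are directed toward it and both vertical edges away from it, entry −1 if both vertical edges are directed toward it and both horizontal edges away from it, and entry 0 otherwise, is a bijection from the set of square-ice configurations on L_n onto the set of alternating sign matrices of order n. -/

import Mathlib

noncomputable section
open Classical

/-- An edge of the unit grid on `ℤ × ℤ`: `⟨p, true⟩` is the horizontal edge from `p` to
`(p.1 + 1, p.2)`; `⟨p, false⟩` is the vertical edge from `p` to `(p.1, p.2 + 1)`. -/
structure GridEdge where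
  pos : ℤ × ℤ
  isHoriz : Bool
deriving DecidableEq

/-- The tail of an edge. -/
def GridEdge.src (e : GridEdge) : ℤ × ℤ := e.pos

/-- The head of an edge. -/
def GridEdge.dst (e : GridEdge) : ℤ × ℤ :=
  if e.isHoriz then (e.pos.1 + 1, e.pos.2) else (e.pos.1, e.pos.2 + 1)

/-- `v` is an interior vertex of `L n`. -/
def Interior (n : ℕ) (v : ℤ × ℤ) : Prop :=
  1 ≤ v.1 ∧ v.1 ≤ (n : ℤ) ∧ 1 ≤ v.2 ∧ v.2 ≤ (n : ℤ)

/-- `e` is an edge of the graph `L n`: it is incident to an interior vertex. -/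
def InL (n : ℕ) (e : GridEdge) : Prop := Interior n e.src ∨ Interior n e.dst


/-- Edges of `L n`. -/
abbrev EdgeIn (n : ℕ) := {e : GridEdge // InL n e}

/-- Extend an orientation of the edges of `L n` to all grid edges (by an irrelevant
default value off `L n`); `o e = true` means `e` is directed from `e.src` to
`e.dst`. -/
def extO (n : ℕ) (o : EdgeIn n → Bool) : GridEdge → Bool :=
  fun e => if h : InL n e then o ⟨e, h⟩ else true

/-- `o` is a square-ice configuration on `L n`: every interior vertex has exactly two
incoming and two outgoing edges, every horizontal boundary edge is directed from the
endpoint toward the interior vertex, and every vertical boundary edge is directed from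
the interior vertex toward the endpoint. -/
def IsIce (n : ℕ) (o : EdgeIn n → Bool) : Prop :=
  (∀ v : ℤ × ℤ, Interior n v →
    ((if extO n o ⟨(v.1 - 1, v.2), true⟩ = true then 1 else 0) +
     (if extO n o ⟨(v.1, v.2 - 1), false⟩ = true then 1 else 0) +
     (if extO n o ⟨v, true⟩ = false then 1 else 0) +
     (if extO n o ⟨v, false⟩ = false then 1 else 0) : ℕ) = 2) ∧
  (∀ e : EdgeIn n, e.1.isHoriz = true → e.1.pos.1 = 0 → o e = true) ∧
  (∀ e : EdgeIn n, e.1.isHoriz = true → e.1.pos.1 = (n : ℤ) → o e = false) ∧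
  (∀ e : EdgeIn n, e.1.isHoriz = false → e.1.pos.2 = 0 → o e = false) ∧
  (∀ e : EdgeIn n, e.1.isHoriz = false → e.1.pos.2 = (n : ℤ) → o e = true)

/-- The nonzero entries of the vector `v` alternate in sign and sum to `1`. -/
def AltVec {m : ℕ} (v : Fin m → ℤ) : Prop :=
  (∀ j₁ j₂ : Fin m, j₁ < j₂ → v j₁ ≠ 0 → v j₂ ≠ 0 →
    (∀ j : Fin m, j₁ < j → j < j₂ → v j = 0) → v j₂ = -v j₁) ∧
  ∑ j, v j = 1

/-- An alternating sign matrix of order `n`: an `n × n` matrix with entries in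
`{-1, 0, 1}` such that in every row and every column the nonzero entries alternate in
sign and sum to `1`. -/
def IsASM (n : ℕ) (M : Matrix (Fin n) (Fin n) ℤ) : Prop :=
  (∀ i j, M i j = 1 ∨ M i j = 0 ∨ M i j = -1) ∧
  (∀ i, AltVec (M i)) ∧ (∀ j, AltVec fun i => M i j)

/-- The matrix entry of a square-ice configuration at the interior vertex `v`: it is
`1` if both horizontal edges at `v` are directed toward `v` and both vertical edges
away from `v`, `-1` if both vertical edges are directed toward `v` and both horizontal
edges away from `v`, and `0` otherwise. -/
def iceEntry (o : GridEdge → Bool) (v : ℤ × ℤ) : ℤ :=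
  if o ⟨(v.1 - 1, v.2), true⟩ = true ∧ o ⟨v, true⟩ = false ∧
     o ⟨(v.1, v.2 - 1), false⟩ = false ∧ o ⟨v, false⟩ = true then 1
  else if o ⟨(v.1, v.2 - 1), false⟩ = true ∧ o ⟨v, false⟩ = false ∧
     o ⟨(v.1 - 1, v.2), true⟩ = false ∧ o ⟨v, true⟩ = true then -1
  else 0

/-- The matrix of a square-ice configuration on `L n`; the `(i, j)` entry corresponds
to the interior vertex in row `i` (from the top) and column `j` (from the left), that
is, to the vertex `(j + 1, n - i)` in `0`-indexed matrix coordinates. -/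
def iceToMatrix (n : ℕ) (o : EdgeIn n → Bool) : Matrix (Fin n) (Fin n) ℤ :=
  fun i j => iceEntry (extO n o) ((j : ℤ) + 1, (n : ℤ) - (i : ℤ))

/-- The sum of the first `k` entries of `v`. -/
def prefixSum {m : ℕ} (v : Fin m → ℤ) (k : ℕ) : ℤ :=
  ∑ j ∈ Finset.range k, if h : j < m then v ⟨j, h⟩ else 0

@[simp] lemma prefixSum_zero {m : ℕ} (v : Fin m → ℤ) : prefixSum v 0 = 0 := by
  simp [prefixSum]

lemma prefixSum_succ {m : ℕ} (v : Fin m → ℤ) (j : Fin m) :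
    prefixSum v (j + 1) = prefixSum v j + v j := by
  simp [prefixSum, Finset.sum_range_succ]

lemma prefixSum_self {m : ℕ} (v : Fin m → ℤ) : prefixSum v m = ∑ j, v j :=
  (Finset.sum_fin_eq_sum_range v).symm

lemma prefixSum_eq_of_zero_between {m : ℕ} (v : Fin m → ℤ) (a b : ℕ) (hab : a ≤ b) (hb : b ≤ m)
    (hz : ∀ j : Fin m, a ≤ j → (j : ℕ) < b → v j = 0) : prefixSum v b = prefixSum v a := by
  induction b, hab using Nat.le_induction with
  | base => rfl
  | succ b hab ih =>
    rw [prefixSum_succ v ⟨b, hb⟩, hz ⟨b, hb⟩ hab (Nat.lt_succ_self b), add_zero]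
    exact ih (by omega) fun j h₁ h₂ => hz j h₁ (by omega)

lemma altVec_of_prefixSum {m : ℕ} (v : Fin m → ℤ)
    (h : ∀ k ≤ m, prefixSum v k = 0 ∨ prefixSum v k = 1) (hm : prefixSum v m = 1) :
    AltVec v := by
  refine ⟨fun j₁ j₂ hlt h₁ h₂ hz => ?_, by rw [← prefixSum_self, hm]⟩
  have e := prefixSum_eq_of_zero_between v (j₁ + 1) j₂ hlt j₂.2.le
    fun j ha hb => hz j ha hb
  have s₁ := prefixSum_succ v j₁
  have s₂ := prefixSum_succ v j₂
  have a₁ := h j₁ j₁.2.le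
  have a₂ := h j₂ j₂.2.le
  have a₃ := h (j₂ + 1) j₂.2
  omega

lemma AltVec.prefixSum_mem {m : ℕ} {v : Fin m → ℤ} (hv : AltVec v) :
    ∀ k ≤ m, prefixSum v k = 0 ∨ prefixSum v k = 1 := by
  obtain ⟨halt, hsum⟩ := hv
  have hne : ∃ k, ∃ h : k < m, v ⟨k, h⟩ ≠ 0 := by
    by_contra! hcon
    have hall : ∀ j, v j = 0 := fun j => hcon j j.2
    simp [hall] at hsum
  obtain ⟨hf, hfne⟩ := Nat.find_spec hne
  have hmin : ∀ j : Fin m, (j : ℕ) < Nat.find hne → v j = 0 := fun j hj => by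
    by_contra hc
    exact Nat.find_min hne hj ⟨j.2, hc⟩
  generalize Nat.find hne = f at hf hfne hmin
  clear hne
  have inv : ∀ k ≤ m, (k ≤ f ∧ prefixSum v k = 0) ∨
      (∃ j : Fin m, (j : ℕ) < k ∧ (∀ i : Fin m, j < i → (i : ℕ) < k → v i = 0) ∧
        ((v j = -v ⟨f, hf⟩ ∧ prefixSum v k = 0) ∨
          (v j = v ⟨f, hf⟩ ∧ prefixSum v k = v ⟨f, hf⟩))) := by
    intro k
    induction k with
    | zero => simp
    | succ k ih =>
      intro hk
      have s := prefixSum_succ v ⟨k, hk⟩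
      simp only at s
      specialize ih (by omega)
      by_cases hz : v ⟨k, hk⟩ = 0
      · rcases ih with ⟨h₁, h₂⟩ | ⟨j, hj, hzero, h⟩
        · have : k ≠ f := by rintro rfl; exact hfne hz
          left; omega
        · refine .inr ⟨j, by omega, fun i hi hik => ?_, by rw [s, hz, add_zero]; exact h⟩
          rcases Nat.lt_succ_iff_lt_or_eq.1 hik with h' | h'
          · exact hzero i hi h'
          · rwa [show i = ⟨k, hk⟩ from Fin.ext h']
      · refine .inr ⟨⟨k, hk⟩, Nat.lt_succ_self k, fun i hi hik => ?_, ?_⟩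
        · simp only [Fin.lt_def] at hi; omega
        rcases ih with ⟨h₁, h₂⟩ | ⟨j, hj, hzero, h⟩
        · have hkf : k = f := by
            by_contra hc
            exact hz (hmin ⟨k, hk⟩ (by simp only; omega))
          subst hkf
          right; exact ⟨rfl, by omega⟩
        · have := halt j ⟨k, hk⟩ hj (by rcases h with h | h <;> omega) hz
            fun i h₁ h₂ => hzero i h₁ h₂
          rcases h with h | h <;> omega
  have hc : v ⟨f, hf⟩ = 1 := by
    have hm := prefixSum_self v
    rcases inv m le_rfl with h | ⟨j, -, -, h⟩ <;> omega
  intro k hk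
  rcases inv k hk with h | ⟨j, -, -, h⟩ <;> omega

/-- Prefix sums of the successive differences of a `Bool`-valued sequence starting at `true`. -/
lemma prefixSum_of_differences {m : ℕ} {v : Fin m → ℤ} {h : ℕ → Bool} (h0 : h 0 = true)
    (hv : ∀ j : Fin m, v j = (h j).toInt - (h (j + 1)).toInt) :
    ∀ k ≤ m, prefixSum v k = 1 - (h k).toInt := by
  intro k
  induction k with
  | zero => simp [h0]
  | succ k ih =>
    intro hk
    have s := prefixSum_succ v ⟨k, hk⟩
    have := hv ⟨k, hk⟩
    have := ih (by omega)
    simp only at *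
    omega

lemma altVec_of_differences {m : ℕ} {v : Fin m → ℤ} {h : ℕ → Bool} (h0 : h 0 = true)
    (hm : h m = false) (hv : ∀ j : Fin m, v j = (h j).toInt - (h (j + 1)).toInt) :
    AltVec v := by
  have hp := prefixSum_of_differences h0 hv
  refine altVec_of_prefixSum v (fun k hk => ?_) (by rw [hp m le_rfl, hm]; simp)
  rw [hp k hk]
  cases h k <;> simp

/-- The state of the horizontal edge of matrix row `i` lying to the left of column `j`. -/
def horizState (n : ℕ) (o : EdgeIn n → Bool) (i j : ℕ) : Bool :=
  extO n o ⟨((j : ℤ), (n : ℤ) - i), true⟩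

/-- The state of the vertical edge of matrix column `j` lying above row `i`. -/
def vertState (n : ℕ) (o : EdgeIn n → Bool) (j i : ℕ) : Bool :=
  extO n o ⟨((j : ℤ) + 1, (n : ℤ) - i), false⟩

lemma inL_horiz_iff {n : ℕ} {x y : ℤ} :
    InL n ⟨(x, y), true⟩ ↔ 0 ≤ x ∧ x ≤ n ∧ 1 ≤ y ∧ y ≤ n := by
  simp only [InL, Interior, GridEdge.src, GridEdge.dst, if_true]
  omega

lemma inL_vert_iff {n : ℕ} {x y : ℤ} :
    InL n ⟨(x, y), false⟩ ↔ 1 ≤ x ∧ x ≤ n ∧ 0 ≤ y ∧ y ≤ n := by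
  simp only [InL, Interior, GridEdge.src, GridEdge.dst, Bool.false_eq_true, if_false]
  omega

lemma extO_of_inL {n : ℕ} (o : EdgeIn n → Bool) {e : GridEdge} (h : InL n e) :
    extO n o e = o ⟨e, h⟩ := dif_pos h

lemma iceToMatrix_apply (n : ℕ) (o : EdgeIn n → Bool) (i j : Fin n) :
    iceToMatrix n o i j =
      if horizState n o i j = true ∧ horizState n o i (j + 1) = false ∧
        vertState n o j (i + 1) = false ∧ vertState n o j i = true then 1
      else if vertState n o j (i + 1) = true ∧ vertState n o j i = false ∧
        horizState n o i j = false ∧ horizState n o i (j + 1) = true then -1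
      else 0 := by
  simp [iceToMatrix, iceEntry, horizState, vertState, sub_sub]

lemma isIce_iff (n : ℕ) (o : EdgeIn n → Bool) :
    IsIce n o ↔
      (∀ i j : Fin n, (horizState n o i j).toInt - (horizState n o i (j + 1)).toInt =
        (vertState n o j i).toInt - (vertState n o j (i + 1)).toInt) ∧
      (∀ i : Fin n, horizState n o i 0 = true) ∧ (∀ i : Fin n, horizState n o i n = false) ∧
      (∀ j : Fin n, vertState n o j n = false) ∧ (∀ j : Fin n, vertState n o j 0 = true) := by
  have local_iff : ∀ a b c d : Bool,
      ((if a = true then 1 else 0) + (if b = true then 1 else 0) +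
        (if c = false then 1 else 0) + (if d = false then 1 else 0) : ℕ) = 2 ↔
      a.toInt - c.toInt = d.toInt - b.toInt := by decide
  have coord : ∀ y : ℤ, 1 ≤ y → y ≤ n → ∃ i : Fin n, y = (n : ℤ) - (i : ℕ) := fun y h₁ h₂ =>
    ⟨⟨(n - y).toNat, by omega⟩, by simp only; omega⟩
  have coord' : ∀ x : ℤ, 1 ≤ x → x ≤ n → ∃ j : Fin n, x = ((j : ℕ) : ℤ) + 1 := fun x h₁ h₂ =>
    ⟨⟨(x - 1).toNat, by omega⟩, by simp only; omega⟩
  unfold IsIce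
  refine and_congr ?_ (and_congr ?_ (and_congr ?_ (and_congr ?_ ?_)))
  · constructor
    · intro h i j
      have := (local_iff _ _ _ _).1 (h ((j : ℤ) + 1, (n : ℤ) - i) (by
        simp only [Interior]; omega))
      simpa [horizState, vertState, sub_sub] using this
    · rintro h ⟨x, y⟩ ⟨h₁, h₂, h₃, h₄⟩
      obtain ⟨i, rfl⟩ := coord y h₃ h₄
      obtain ⟨j, rfl⟩ := coord' x h₁ h₂
      rw [local_iff]
      simpa [horizState, vertState, sub_sub] using h i j
  · constructor
    · intro h i
      have hi : InL n ⟨(((0 : ℕ) : ℤ), (n : ℤ) - (i : ℕ)), true⟩ := inL_horiz_iff.2 (by omega)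
      rw [horizState, extO_of_inL o hi]
      exact h _ rfl rfl
    · rintro h ⟨⟨⟨x, y⟩, b⟩, he⟩ rfl rfl
      obtain ⟨i, rfl⟩ := coord y (inL_horiz_iff.1 he).2.2.1 (inL_horiz_iff.1 he).2.2.2
      rw [← extO_of_inL o he]
      exact h i
  · constructor
    · intro h i
      have hi : InL n ⟨((n : ℤ), (n : ℤ) - (i : ℕ)), true⟩ := inL_horiz_iff.2 (by omega)
      rw [horizState, extO_of_inL o hi]
      exact h _ rfl rfl
    · rintro h ⟨⟨⟨x, y⟩, b⟩, he⟩ rfl rfl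
      obtain ⟨i, rfl⟩ := coord y (inL_horiz_iff.1 he).2.2.1 (inL_horiz_iff.1 he).2.2.2
      rw [← extO_of_inL o he]
      exact h i
  · constructor
    · intro h j
      have hj : InL n ⟨((j : ℤ) + 1, (n : ℤ) - (n : ℕ)), false⟩ := inL_vert_iff.2 (by omega)
      rw [vertState, extO_of_inL o hj]
      exact h _ rfl (sub_self _)
    · rintro h ⟨⟨⟨x, y⟩, b⟩, he⟩ rfl rfl
      obtain ⟨j, rfl⟩ := coord' x (inL_vert_iff.1 he).1 (inL_vert_iff.1 he).2.1
      rw [← extO_of_inL o he]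
      simpa [vertState] using h j
  · constructor
    · intro h j
      have hj : InL n ⟨((j : ℤ) + 1, (n : ℤ) - (0 : ℕ)), false⟩ := inL_vert_iff.2 (by omega)
      rw [vertState, extO_of_inL o hj]
      exact h _ rfl (by simp)
    · rintro h ⟨⟨⟨x, y⟩, b⟩, he⟩ rfl rfl
      obtain ⟨j, rfl⟩ := coord' x (inL_vert_iff.1 he).1 (inL_vert_iff.1 he).2.1
      rw [← extO_of_inL o he]
      simpa [vertState] using h j

lemma eq_of_states_eq {n : ℕ} {o o' : EdgeIn n → Bool}
    (hh : ∀ i : Fin n, ∀ k ≤ n, horizState n o i k = horizState n o' i k)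
    (hv : ∀ j : Fin n, ∀ k ≤ n, vertState n o j k = vertState n o' j k) : o = o' := by
  funext ⟨⟨⟨x, y⟩, b⟩, he⟩
  rw [← extO_of_inL o he, ← extO_of_inL o' he]
  cases b
  · obtain ⟨h₁, h₂, h₃, h₄⟩ := inL_vert_iff.1 he
    have := hv ⟨(x - 1).toNat, by omega⟩ (n - y).toNat (by omega)
    have e₁ : ((x - 1).toNat : ℤ) + 1 = x := by omega
    have e₂ : (n : ℤ) - ((n - y).toNat : ℕ) = y := by omega
    simpa only [vertState, e₁, e₂] using this
  · obtain ⟨h₁, h₂, h₃, h₄⟩ := inL_horiz_iff.1 he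
    have := hh ⟨(n - y).toNat, by omega⟩ x.toNat (by omega)
    have e₁ : (x.toNat : ℤ) = x := by omega
    have e₂ : (n : ℤ) - ((n - y).toNat : ℕ) = y := by omega
    simpa only [horizState, e₁, e₂] using this

lemma iceToMatrix_eq_horiz_sub {n : ℕ} {o : EdgeIn n → Bool} {i j : Fin n}
    (h : (horizState n o i j).toInt - (horizState n o i (j + 1)).toInt =
        (vertState n o j i).toInt - (vertState n o j (i + 1)).toInt) :
    iceToMatrix n o i j = (horizState n o i j).toInt - (horizState n o i (j + 1)).toInt := by
  rw [iceToMatrix_apply]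
  revert h
  generalize horizState n o i j = a, horizState n o i (j + 1) = b,
    vertState n o j i = c, vertState n o j (i + 1) = d
  revert a b c d
  decide

lemma IsIce.prefixSum_row {n : ℕ} {o : EdgeIn n → Bool} (ho : IsIce n o) (i : Fin n) :
    ∀ k ≤ n, prefixSum (iceToMatrix n o i) k = 1 - (horizState n o i k).toInt := by
  obtain ⟨h, h0, -⟩ := (isIce_iff n o).1 ho
  exact prefixSum_of_differences (h := horizState n o i) (h0 i)
    fun j => iceToMatrix_eq_horiz_sub (h i j)

lemma IsIce.prefixSum_col {n : ℕ} {o : EdgeIn n → Bool} (ho : IsIce n o) (j : Fin n) :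
    ∀ k ≤ n, prefixSum (fun i => iceToMatrix n o i j) k = 1 - (vertState n o j k).toInt := by
  obtain ⟨h, -, -, -, h0⟩ := (isIce_iff n o).1 ho
  exact prefixSum_of_differences (h := vertState n o j) (h0 j)
    fun i => (iceToMatrix_eq_horiz_sub (h i j)).trans (h i j)

lemma IsIce.isASM {n : ℕ} {o : EdgeIn n → Bool} (ho : IsIce n o) : IsASM n (iceToMatrix n o) := by
  obtain ⟨h, hl, hr, hb, ht⟩ := (isIce_iff n o).1 ho
  refine ⟨fun i j => ?_, fun i => ?_, fun j => ?_⟩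
  · rw [iceToMatrix_apply]
    split_ifs <;> simp
  · exact altVec_of_differences (h := horizState n o i) (hl i) (hr i)
      fun j => iceToMatrix_eq_horiz_sub (h i j)
  · exact altVec_of_differences (h := vertState n o j) (ht j) (hb j)
      fun i => (iceToMatrix_eq_horiz_sub (h i j)).trans (h i j)

/-- The orientation of `L n` read off from the row and column prefix sums of a matrix. -/
def matrixToIce (n : ℕ) (M : Matrix (Fin n) (Fin n) ℤ) : EdgeIn n → Bool := fun e =>
  if e.1.isHoriz then
    decide (∃ i : Fin n, (i : ℤ) = n - e.1.pos.2 ∧ prefixSum (M i) e.1.pos.1.toNat = 0)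
  else
    decide (∃ j : Fin n, (j : ℤ) + 1 = e.1.pos.1 ∧
      prefixSum (fun i => M i j) (n - e.1.pos.2).toNat = 0)

lemma horizState_matrixToIce {n : ℕ} (M : Matrix (Fin n) (Fin n) ℤ) (i : Fin n) {k : ℕ}
    (hk : k ≤ n) : horizState n (matrixToIce n M) i k = decide (prefixSum (M i) k = 0) := by
  have hi : InL n ⟨((k : ℤ), (n : ℤ) - (i : ℕ)), true⟩ := inL_horiz_iff.2 (by omega)
  rw [horizState, extO_of_inL _ hi]
  simp [matrixToIce, Fin.val_inj]

lemma vertState_matrixToIce {n : ℕ} (M : Matrix (Fin n) (Fin n) ℤ) (j : Fin n) {k : ℕ}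
    (hk : k ≤ n) :
    vertState n (matrixToIce n M) j k = decide (prefixSum (fun i => M i j) k = 0) := by
  have hj : InL n ⟨((j : ℕ) + 1, (n : ℤ) - (k : ℕ)), false⟩ := inL_vert_iff.2 (by omega)
  rw [vertState, extO_of_inL _ hj]
  simp [matrixToIce, Fin.val_inj]

lemma differences_decide_prefixSum {m : ℕ} {v : Fin m → ℤ}
    (h : ∀ k ≤ m, prefixSum v k = 0 ∨ prefixSum v k = 1) (j : Fin m) :
    (decide (prefixSum v j = 0)).toInt - (decide (prefixSum v (j + 1) = 0)).toInt = v j := by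
  have s := prefixSum_succ v j
  rcases h j j.2.le with h₁ | h₁ <;> rcases h (j + 1) j.2 with h₂ | h₂ <;> simp [h₁, h₂] <;> omega

lemma IsASM.matrixToIce {n : ℕ} {M : Matrix (Fin n) (Fin n) ℤ} (hM : IsASM n M) :
    IsIce n (matrixToIce n M) ∧ iceToMatrix n (matrixToIce n M) = M := by
  obtain ⟨-, hr, hc⟩ := hM
  have hrow : ∀ i j : Fin n, (horizState n (_root_.matrixToIce n M) i j).toInt -
      (horizState n (_root_.matrixToIce n M) i (j + 1)).toInt = M i j := fun i j => by
    rw [horizState_matrixToIce M i j.2.le, horizState_matrixToIce M i j.2]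
    exact differences_decide_prefixSum (hr i).prefixSum_mem j
  have hcol : ∀ i j : Fin n, (vertState n (_root_.matrixToIce n M) j i).toInt -
      (vertState n (_root_.matrixToIce n M) j (i + 1)).toInt = M i j := fun i j => by
    rw [vertState_matrixToIce M j i.2.le, vertState_matrixToIce M j i.2]
    exact differences_decide_prefixSum (hc j).prefixSum_mem i
  have hflow := fun i j => (hrow i j).trans (hcol i j).symm
  refine ⟨(isIce_iff _ _).2 ⟨hflow, fun i => ?_, fun i => ?_, fun j => ?_, fun j => ?_⟩, ?_⟩
  · simp [horizState_matrixToIce M i n.zero_le]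
  · simp [horizState_matrixToIce M i le_rfl, prefixSum_self, (hr i).2]
  · simp [vertState_matrixToIce M j le_rfl, prefixSum_self, (hc j).2]
  · simp [vertState_matrixToIce M j n.zero_le]
  · ext i j
    rw [iceToMatrix_eq_horiz_sub (hflow i j), hrow]

/-- The map sending a square-ice configuration on `L n` to its matrix is a bijection
from the set of square-ice configurations on `L n` onto the set of alternating sign
matrices of order `n`. -/
theorem iceToMatrix_bijOn (n : ℕ) (hn : 1 ≤ n) :
    Set.BijOn (iceToMatrix n) {o | IsIce n o} {M | IsASM n M} := by
  refine ⟨fun o ho => IsIce.isASM ho, fun o ho o' ho' heq => ?_, fun M hM =>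
    ⟨matrixToIce n M, IsASM.matrixToIce hM⟩⟩
  have toInt_inj : ∀ a b : Bool, 1 - a.toInt = 1 - b.toInt → a = b := by decide
  refine eq_of_states_eq (fun i k hk => toInt_inj _ _ ?_) (fun j k hk => toInt_inj _ _ ?_)
  · rw [← IsIce.prefixSum_row ho i k hk, ← IsIce.prefixSum_row ho' i k hk, heq]
  · rw [← IsIce.prefixSum_col ho j k hk, ← IsIce.prefixSum_col ho' j k hk, heq]
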